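/- arXiv:1710.09177 — 2 statements merged into one kernel-verified Lean document; each statement's English description precedes it below -/
import Mathlib

section
/- If α ≥ n/2, then C_{h,σ²}(A, αA) = sup over all laws of a scalar random variable X̄ with P(X̄ ∈ [0, s_n A]) = 1 of I(X̄; X̄ + Z), and this in turn equals C_{1,σ²}(s_n A, s_n A / 2), the capacity of the unit-gain SISO channel under peak-power constraint s_n A and average-power constraint s_n A / 2. -/
open MeasureTheory ProbabilityTheory Real Filter
open scoped NNReal ENNReal Classical

noncomputable section

/-- Kullback–Leibler divergence (Mathlib's `ProbabilityTheory.klDiv`). -/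
def klDiv {α : Type*} [MeasurableSpace α] (μ ν : Measure α) : EReal :=
  if μ ≪ ν ∧ Integrable (llr μ ν) μ then ((∫ x, llr μ ν x ∂μ : ℝ) : EReal) else ⊤

/-- Mutual information of a joint law: KL divergence of the joint law from the
product of its marginals. -/
def mutualInfo {α β : Type*} [MeasurableSpace α] [MeasurableSpace β]
    (joint : Measure (α × β)) : EReal :=
  klDiv joint ((joint.map Prod.fst).prod (joint.map Prod.snd))

/-- Partial sums `s_k = h_1 + ⋯ + h_k`. -/
def sCum {n : ℕ} (h : Fin n → ℝ) (k : ℕ) : ℝ :=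
  ∑ i : Fin n, if i.val < k then h i else 0

/-- Joint law of `(X, Y)` with `Y = hᵀX + Z`, `Z ~ N(0, v)` independent of `X`. -/
def misoJoint {n : ℕ} (h : Fin n → ℝ) (v : ℝ≥0) (μ : Measure (Fin n → ℝ)) :
    Measure ((Fin n → ℝ) × ℝ) :=
  (μ.prod (gaussianReal 0 v)).map (fun p => (p.1, (∑ k, h k * p.1 k) + p.2))

/-- MISO capacity under peak-power constraint `A` and average-power constraint `E`. -/
def misoCapacity {n : ℕ} (h : Fin n → ℝ) (v : ℝ≥0) (A E : ℝ) : EReal :=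
  ⨆ μ ∈ {μ : Measure (Fin n → ℝ) | IsProbabilityMeasure μ ∧
      (∀ k, ∀ᵐ x ∂μ, x k ∈ Set.Icc 0 A) ∧ (∑ k, ∫ x, x k ∂μ) ≤ E},
    mutualInfo (misoJoint h v μ)

/-- MISO capacity under only an average-power constraint `E`. -/
def misoCapacityAvg {n : ℕ} (h : Fin n → ℝ) (v : ℝ≥0) (E : ℝ) : EReal :=
  ⨆ μ ∈ {μ : Measure (Fin n → ℝ) | IsProbabilityMeasure μ ∧
      (∀ k, ∀ᵐ x ∂μ, 0 ≤ x k) ∧ (∑ k, ∫ x, x k ∂μ) ≤ E},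
    mutualInfo (misoJoint h v μ)

/-- Joint law of `(X̄, X̄ + Z)` for the unit-gain SISO channel. -/
def sisoJoint (v : ℝ≥0) (μ : Measure ℝ) : Measure (ℝ × ℝ) :=
  (μ.prod (gaussianReal 0 v)).map (fun p => (p.1, p.1 + p.2))

/-- Unit-gain SISO capacity under peak-power constraint `A` and average-power
constraint `E`. -/
def sisoCapacity (v : ℝ≥0) (A E : ℝ) : EReal :=
  ⨆ μ ∈ {μ : Measure ℝ | IsProbabilityMeasure μ ∧
      (∀ᵐ x ∂μ, x ∈ Set.Icc 0 A) ∧ (∫ x, x ∂μ) ≤ E},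
    mutualInfo (sisoJoint v μ)

/-- Unit-gain SISO capacity under only an average-power constraint `E`. -/
def sisoCapacityAvg (v : ℝ≥0) (E : ℝ) : EReal :=
  ⨆ μ ∈ {μ : Measure ℝ | IsProbabilityMeasure μ ∧
      (∀ᵐ x ∂μ, 0 ≤ x) ∧ (∫ x, x ∂μ) ≤ E},
    mutualInfo (sisoJoint v μ)

/-- The interval `(s_{k-1} A, s_k A]` (with the first one being `[0, s_1 A]`)
corresponding to the event `U = k` (0-indexed: `k ∈ Fin n` stands for `k+1`). -/
def uInterval {n : ℕ} (h : Fin n → ℝ) (A : ℝ) (k : Fin n) : Set ℝ :=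
  if k.val = 0 then Set.Icc 0 (sCum h 1 * A)
  else Set.Ioc (sCum h k.val * A) (sCum h (k.val + 1) * A)

/-- The average input power `∑_k p_k ((E[X̄ | U=k] - A s_{k-1})/h_k + (k-1) A)`
consumed to generate a scalar law of `X̄`. -/
def avgPowerUse {n : ℕ} (h : Fin n → ℝ) (A : ℝ) (μ : Measure ℝ) : ℝ :=
  ∑ k : Fin n,
    (((∫ x in uInterval h A k, x ∂μ) - A * sCum h k.val * (μ (uInterval h A k)).toReal) / h k
      + (k.val : ℝ) * A * (μ (uInterval h A k)).toReal)

/-- The threshold `α_th`. -/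
def alphaTh {n : ℕ} (h : Fin n → ℝ) : ℝ :=
  1 / 2 + (1 / sCum h n) * ∑ k : Fin n, h k * (k.val : ℝ)


end

noncomputable section

/-- Density of the output of the additive Gaussian noise channel whose input has law `ν`. -/
def outputPDF (v : ℝ≥0) (ν : Measure ℝ) (y : ℝ) : ℝ := ∫ x, gaussianPDFReal x v y ∂ν

/-- Joint law of `(X, T X + Z)` where `X` has law `P` and `Z ~ N(0, v)` is independent of `X`. -/
def channelJoint {Ω : Type*} [MeasurableSpace Ω] (v : ℝ≥0) (P : Measure Ω) (T : Ω → ℝ) :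
    Measure (Ω × ℝ) :=
  (P.prod (gaussianReal 0 v)).map (fun p => (p.1, T p.1 + p.2))

lemma gaussianPDFReal_le (x : ℝ) (v : ℝ≥0) (y : ℝ) :
    gaussianPDFReal x v y ≤ (√(2 * π * v))⁻¹ := by
  rw [gaussianPDFReal]
  refine mul_le_of_le_one_right (by positivity) ?_
  rw [Real.exp_le_one_iff, neg_div]
  exact neg_nonpos.2 (by positivity)

lemma le_gaussianPDFReal {x : ℝ} {v : ℝ≥0} {R : ℝ} (hv : 0 < v) (hx : |x| ≤ R) (y : ℝ) :
    (√(2 * π * v))⁻¹ * rexp (-((y ^ 2 + R ^ 2) / v)) ≤ gaussianPDFReal x v y := by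
  have hv' : (0 : ℝ) < v := hv
  rw [gaussianPDFReal]
  refine mul_le_mul_of_nonneg_left (Real.exp_le_exp.2 ?_) (by positivity)
  have hx2 : x ^ 2 ≤ R ^ 2 := sq_le_sq' (by linarith [abs_le.1 hx]) (abs_le.1 hx).2
  rw [neg_div, neg_le_neg_iff, div_le_div_iff₀ (by positivity) hv']
  nlinarith [mul_nonneg hv'.le (sq_nonneg (y + x)), mul_nonneg hv'.le (sub_nonneg.2 hx2)]

lemma measurable_gaussianPDFReal_mean (v : ℝ≥0) (y : ℝ) :
    Measurable (fun x => gaussianPDFReal x v y) :=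
  measurable_uncurry_gaussianPDFReal.comp (by fun_prop : Measurable fun x : ℝ => (x, v, y))

lemma integrable_gaussianPDFReal_mean (v : ℝ≥0) (ν : Measure ℝ) [IsFiniteMeasure ν] (y : ℝ) :
    Integrable (fun x => gaussianPDFReal x v y) ν := by
  refine Integrable.of_bound (measurable_gaussianPDFReal_mean v y).aestronglyMeasurable
    (√(2 * π * v))⁻¹ (.of_forall fun x => ?_)
  rw [Real.norm_of_nonneg (gaussianPDFReal_nonneg _ _ _)]
  exact gaussianPDFReal_le x v y

lemma outputPDF_le (v : ℝ≥0) (ν : Measure ℝ) [IsProbabilityMeasure ν] (y : ℝ) :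
    outputPDF v ν y ≤ (√(2 * π * v))⁻¹ := by
  simpa [outputPDF] using integral_mono (integrable_gaussianPDFReal_mean v ν y)
    (integrable_const (√(2 * π * v))⁻¹) (fun x => gaussianPDFReal_le x v y)

lemma le_outputPDF {v : ℝ≥0} (hv : 0 < v) {ν : Measure ℝ} [IsProbabilityMeasure ν] {R : ℝ}
    (hν : ∀ᵐ x ∂ν, |x| ≤ R) (y : ℝ) :
    (√(2 * π * v))⁻¹ * rexp (-((y ^ 2 + R ^ 2) / v)) ≤ outputPDF v ν y := by
  simpa [outputPDF] using integral_mono_ae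
    (integrable_const ((√(2 * π * v))⁻¹ * rexp (-((y ^ 2 + R ^ 2) / v))))
    (integrable_gaussianPDFReal_mean v ν y)
    (hν.mono fun x hx => le_gaussianPDFReal hv hx y)

lemma outputPDF_nonneg (v : ℝ≥0) (ν : Measure ℝ) (y : ℝ) : 0 ≤ outputPDF v ν y :=
  integral_nonneg fun _ => gaussianPDFReal_nonneg _ _ _

lemma outputPDF_pos {v : ℝ≥0} (hv : 0 < v) {ν : Measure ℝ} [IsProbabilityMeasure ν] {R : ℝ}
    (hν : ∀ᵐ x ∂ν, |x| ≤ R) (y : ℝ) : 0 < outputPDF v ν y := by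
  have hv' : (0 : ℝ) < v := hv
  exact lt_of_lt_of_le (by positivity) (le_outputPDF hv hν y)

lemma abs_log_outputPDF_le {v : ℝ≥0} (hv : 0 < v) {ν : Measure ℝ} [IsProbabilityMeasure ν]
    {R : ℝ} (hν : ∀ᵐ x ∂ν, |x| ≤ R) (y : ℝ) :
    |log (outputPDF v ν y)| ≤ |log (√(2 * π * v))⁻¹| + (y ^ 2 + R ^ 2) / v := by
  have hv' : (0 : ℝ) < v := hv
  have hC : 0 < (√(2 * π * v))⁻¹ := by positivity
  have h1 := Real.log_le_log (outputPDF_pos hv hν y) (outputPDF_le v ν y)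
  have h2 := Real.log_le_log (by positivity) (le_outputPDF hv hν y)
  rw [Real.log_mul hC.ne' (Real.exp_pos _).ne', Real.log_exp] at h2
  have h3 : 0 ≤ (y ^ 2 + R ^ 2) / v := by positivity
  rw [abs_le]
  constructor <;> linarith [neg_abs_le (log (√(2 * π * v))⁻¹), le_abs_self (log (√(2 * π * v))⁻¹)]

lemma measurable_outputPDF (v : ℝ≥0) (ν : Measure ℝ) [SFinite ν] :
    Measurable (outputPDF v ν) := by
  have : StronglyMeasurable (fun p : ℝ × ℝ => gaussianPDFReal p.2 v p.1) :=
    (measurable_uncurry_gaussianPDFReal.comp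
      (by fun_prop : Measurable fun p : ℝ × ℝ => (p.2, v, p.1))).stronglyMeasurable
  exact (this.integral_prod_right (ν := ν)).measurable

lemma ofReal_outputPDF (v : ℝ≥0) (ν : Measure ℝ) [IsFiniteMeasure ν] (y : ℝ) :
    ENNReal.ofReal (outputPDF v ν y) = ∫⁻ x, gaussianPDF x v y ∂ν :=
  ofReal_integral_eq_lintegral_ofReal (integrable_gaussianPDFReal_mean v ν y)
    (.of_forall fun _ => gaussianPDFReal_nonneg _ _ _)

section Channel

variable {Ω : Type*} [MeasurableSpace Ω] {v : ℝ≥0} {P : Measure Ω} {T : Ω → ℝ}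

lemma measurable_channel (hT : Measurable T) :
    Measurable (fun p : Ω × ℝ => (p.1, T p.1 + p.2)) := by fun_prop

lemma measurable_channel_density (v : ℝ≥0) (hT : Measurable T) :
    Measurable (fun p : Ω × ℝ => gaussianPDF (T p.1) v p.2) :=
  measurable_uncurry_gaussianPDF.comp (by fun_prop : Measurable fun p : Ω × ℝ => (T p.1, v, p.2))

lemma channelJoint_eq_withDensity [SFinite P] (hv : 0 < v) (hT : Measurable T) :
    channelJoint v P T = (P.prod volume).withDensity (fun p => gaussianPDF (T p.1) v p.2) := by
  ext s hs
  rw [channelJoint, Measure.map_apply (measurable_channel hT) hs,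
    Measure.prod_apply (measurable_channel hT hs), withDensity_apply _ hs,
    ← lintegral_indicator hs,
    lintegral_prod _ ((measurable_channel_density v hT).indicator hs).aemeasurable]
  refine lintegral_congr fun ω => ?_
  have hsω : MeasurableSet (Prod.mk ω ⁻¹' s) := measurable_prodMk_left hs
  calc gaussianReal 0 v (Prod.mk ω ⁻¹' ((fun p : Ω × ℝ => (p.1, T p.1 + p.2)) ⁻¹' s))
      = (gaussianReal 0 v).map (fun z => T ω + z) (Prod.mk ω ⁻¹' s) := by
        rw [Measure.map_apply (by fun_prop) hsω]
        rfl
    _ = ∫⁻ y, (Prod.mk ω ⁻¹' s).indicator (gaussianPDF (T ω) v) y := by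
        rw [gaussianReal_map_const_add, zero_add, gaussianReal_apply _ hv.ne',
          lintegral_indicator hsω]
    _ = _ := lintegral_congr fun y => rfl

lemma channelJoint_map_fst [SFinite P] (hT : Measurable T) :
    (channelJoint v P T).map Prod.fst = P := by
  rw [channelJoint, Measure.map_map measurable_fst (measurable_channel hT)]
  exact (Measure.map_fst_prod (μ := P) (ν := gaussianReal 0 v)).trans (by simp)

lemma channelJoint_map_snd [IsFiniteMeasure P] (hv : 0 < v) (hT : Measurable T) :
    (channelJoint v P T).map Prod.snd =
      volume.withDensity (fun y => ENNReal.ofReal (outputPDF v (P.map T) y)) := by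
  ext s hs
  rw [Measure.map_apply measurable_snd hs, channelJoint_eq_withDensity hv hT,
    withDensity_apply _ (measurable_snd hs), withDensity_apply _ hs, ← Set.univ_prod,
    ← Measure.prod_restrict, Measure.restrict_univ,
    lintegral_prod_symm' _ (measurable_channel_density v hT)]
  refine lintegral_congr fun y => ?_
  rw [ofReal_outputPDF, lintegral_map _ hT]
  exact (measurable_gaussianPDFReal_mean v y).ennreal_ofReal

lemma channelJoint_eq_withDensity_prod [IsProbabilityMeasure P] (hv : 0 < v) (hT : Measurable T)
    {R : ℝ} (hR : ∀ᵐ x ∂(P.map T), |x| ≤ R) :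
    channelJoint v P T =
      (((channelJoint v P T).map Prod.fst).prod ((channelJoint v P T).map Prod.snd)).withDensity
        (fun p => ENNReal.ofReal (gaussianPDFReal (T p.1) v p.2 / outputPDF v (P.map T) p.2)) := by
  have := Measure.isProbabilityMeasure_map (μ := P) hT.aemeasurable
  have hq := measurable_outputPDF v (P.map T)
  have hg : Measurable (fun p : Ω × ℝ => gaussianPDFReal (T p.1) v p.2) :=
    measurable_uncurry_gaussianPDFReal.comp
      (by fun_prop : Measurable fun p : Ω × ℝ => (T p.1, v, p.2))
  rw [channelJoint_map_fst hT, channelJoint_map_snd hv hT,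
    prod_withDensity_right hq.ennreal_ofReal, ← withDensity_mul _ (by fun_prop) (by fun_prop),
    channelJoint_eq_withDensity hv hT]
  congr 1
  funext p
  have hpos := outputPDF_pos hv hR p.2
  rw [Pi.mul_apply, ← ENNReal.ofReal_mul hpos.le, mul_div_cancel₀ _ hpos.ne', gaussianPDF]

lemma llr_channelJoint [IsProbabilityMeasure P] (hv : 0 < v) (hT : Measurable T)
    {R : ℝ} (hR : ∀ᵐ x ∂(P.map T), |x| ≤ R) :
    llr (channelJoint v P T)
        (((channelJoint v P T).map Prod.fst).prod ((channelJoint v P T).map Prod.snd))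
      =ᵐ[channelJoint v P T] fun p =>
        log (gaussianPDFReal (T p.1) v p.2) - log (outputPDF v (P.map T) p.2) := by
  have := Measure.isProbabilityMeasure_map (μ := P) hT.aemeasurable
  have hq := measurable_outputPDF v (P.map T)
  have hg : Measurable (fun p : Ω × ℝ => gaussianPDFReal (T p.1) v p.2) :=
    measurable_uncurry_gaussianPDFReal.comp
      (by fun_prop : Measurable fun p : Ω × ℝ => (T p.1, v, p.2))
  have hJ : IsProbabilityMeasure (channelJoint v P T) :=
    Measure.isProbabilityMeasure_map (measurable_channel hT).aemeasurable
  have hsnd := Measure.isProbabilityMeasure_map (μ := channelJoint v P T)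
    measurable_snd.aemeasurable
  have hfst := Measure.isProbabilityMeasure_map (μ := channelJoint v P T)
    measurable_fst.aemeasurable
  set Q := ((channelJoint v P T).map Prod.fst).prod ((channelJoint v P T).map Prod.snd) with hQ
  have hJQ := channelJoint_eq_withDensity_prod hv hT hR
  rw [← hQ] at hJQ
  have hac : channelJoint v P T ≪ Q := by
    rw [hJQ]
    exact withDensity_absolutelyContinuous _ _
  have hrn : (channelJoint v P T).rnDeriv Q =ᵐ[Q] fun p =>
      ENNReal.ofReal (gaussianPDFReal (T p.1) v p.2 / outputPDF v (P.map T) p.2) := by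
    conv_lhs => rw [hJQ]
    exact Measure.rnDeriv_withDensity Q (by fun_prop)
  filter_upwards [hac.ae_le hrn] with p hp
  have hpos := outputPDF_pos hv hR p.2
  have hgpos := gaussianPDFReal_pos (T p.1) v p.2 hv.ne'
  rw [llr, hp, ENNReal.toReal_ofReal (by positivity), Real.log_div hgpos.ne' hpos.ne']

lemma integrable_sq_gaussianReal (v : ℝ≥0) : Integrable (fun z => z ^ 2) (gaussianReal 0 v) :=
  (memLp_id_gaussianReal (μ := 0) (v := v) 2).integrable_sq

lemma integrable_log_gaussianPDFReal (hv : 0 < v) :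
    Integrable (fun z => log (gaussianPDFReal 0 v z)) (gaussianReal 0 v) := by
  have hv' : (0 : ℝ) < v := hv
  have : (fun z => log (gaussianPDFReal 0 v z)) =
      fun z => log (√(2 * π * v))⁻¹ + z ^ 2 * (-(2 * v : ℝ)⁻¹) := by
    funext z
    rw [gaussianPDFReal, Real.log_mul (by positivity) (Real.exp_pos _).ne', Real.log_exp]
    ring
  rw [this]
  exact (integrable_const _).add ((integrable_sq_gaussianReal v).mul_const _)

lemma gaussianPDFReal_self_add (x : ℝ) (v : ℝ≥0) (z : ℝ) :
    gaussianPDFReal x v (x + z) = gaussianPDFReal 0 v z := by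
  simp [gaussianPDFReal]

lemma integrable_log_gaussianPDFReal_channelJoint [IsProbabilityMeasure P] (hv : 0 < v)
    (hT : Measurable T) :
    Integrable (fun p => log (gaussianPDFReal (T p.1) v p.2)) (channelJoint v P T) := by
  have hg : Measurable (fun p : Ω × ℝ => log (gaussianPDFReal (T p.1) v p.2)) :=
    (measurable_uncurry_gaussianPDFReal.comp
      (by fun_prop : Measurable fun p : Ω × ℝ => (T p.1, v, p.2))).log
  rw [channelJoint, integrable_map_measure hg.aestronglyMeasurable
    (measurable_channel hT).aemeasurable]
  refine ((integrable_log_gaussianPDFReal hv).comp_snd P).congr (.of_forall fun p => ?_)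
  exact congrArg log (gaussianPDFReal_self_add _ _ _).symm

lemma integral_log_gaussianPDFReal_channelJoint [IsProbabilityMeasure P] (hT : Measurable T) :
    ∫ p, log (gaussianPDFReal (T p.1) v p.2) ∂(channelJoint v P T) =
      ∫ z, log (gaussianPDFReal 0 v z) ∂(gaussianReal 0 v) := by
  have hg : Measurable (fun p : Ω × ℝ => log (gaussianPDFReal (T p.1) v p.2)) :=
    (measurable_uncurry_gaussianPDFReal.comp
      (by fun_prop : Measurable fun p : Ω × ℝ => (T p.1, v, p.2))).log
  rw [channelJoint, integral_map (measurable_channel hT).aemeasurable hg.aestronglyMeasurable]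
  simp only [gaussianPDFReal_self_add]
  simpa using integral_fun_snd (μ := P) (ν := gaussianReal 0 v)
    (fun z => log (gaussianPDFReal 0 v z))

lemma integrable_log_outputPDF_channelJoint [IsProbabilityMeasure P] (hv : 0 < v)
    (hT : Measurable T) {R : ℝ} (hR : ∀ᵐ x ∂(P.map T), |x| ≤ R) :
    Integrable (fun p => log (outputPDF v (P.map T) p.2)) (channelJoint v P T) := by
  have hv' : (0 : ℝ) < v := hv
  have := Measure.isProbabilityMeasure_map (μ := P) hT.aemeasurable
  have hq := measurable_outputPDF v (P.map T)
  have hlog : Measurable (fun p : Ω × ℝ => log (outputPDF v (P.map T) p.2)) :=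
    (hq.comp measurable_snd).log
  rw [channelJoint, integrable_map_measure hlog.aestronglyMeasurable
    (measurable_channel hT).aemeasurable]
  have hbound : Integrable (fun p : Ω × ℝ => |log (√(2 * π * v))⁻¹| +
      (2 * p.2 ^ 2 + 3 * R ^ 2) / v) (P.prod (gaussianReal 0 v)) :=
    (integrable_const _).add (((((integrable_sq_gaussianReal v).comp_snd P).const_mul 2).add
      (integrable_const _)).div_const _)
  refine hbound.mono' (hlog.comp (measurable_channel hT)).aestronglyMeasurable ?_
  have hT' : ∀ᵐ p ∂(P.prod (gaussianReal 0 v)), |T p.1| ≤ R :=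
    Measure.quasiMeasurePreserving_fst.ae (ae_of_ae_map hT.aemeasurable hR)
  filter_upwards [hT'] with p hp
  refine (abs_log_outputPDF_le hv hR _).trans ?_
  have hx2 : T p.1 ^ 2 ≤ R ^ 2 := sq_le_sq' (by linarith [abs_le.1 hp]) (abs_le.1 hp).2
  have hsq : (T p.1 + p.2) ^ 2 + R ^ 2 ≤ 2 * p.2 ^ 2 + 3 * R ^ 2 := by
    nlinarith [sq_nonneg (T p.1 - p.2)]
  exact add_le_add_right (div_le_div_of_nonneg_right hsq hv'.le) _

lemma integral_log_outputPDF_channelJoint [IsProbabilityMeasure P] (hv : 0 < v)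
    (hT : Measurable T) :
    ∫ p, log (outputPDF v (P.map T) p.2) ∂(channelJoint v P T) =
      -∫ y, negMulLog (outputPDF v (P.map T) y) := by
  have := Measure.isProbabilityMeasure_map (μ := P) hT.aemeasurable
  have hq := measurable_outputPDF v (P.map T)
  rw [← integral_map (φ := Prod.snd) (f := fun y => log (outputPDF v (P.map T) y))
    measurable_snd.aemeasurable hq.log.aestronglyMeasurable, channelJoint_map_snd hv hT,
    integral_withDensity_eq_integral_toReal_smul hq.ennreal_ofReal (by simp), ← integral_neg]
  refine integral_congr_ae (.of_forall fun y => ?_)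
  simp [negMulLog, ENNReal.toReal_ofReal (outputPDF_nonneg _ _ _)]

lemma mutualInfo_channelJoint [IsProbabilityMeasure P] (hv : 0 < v)
    (hT : Measurable T) {R : ℝ} (hR : ∀ᵐ x ∂(P.map T), |x| ≤ R) :
    mutualInfo (channelJoint v P T) =
      ((∫ z, log (gaussianPDFReal 0 v z) ∂(gaussianReal 0 v) +
        ∫ y, negMulLog (outputPDF v (P.map T) y) : ℝ) : EReal) := by
  have h_int1 := integrable_log_gaussianPDFReal_channelJoint (P := P) hv hT
  have h_int2 := integrable_log_outputPDF_channelJoint hv hT hR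
  have hllr := llr_channelJoint hv hT hR
  have hac : channelJoint v P T ≪
      ((channelJoint v P T).map Prod.fst).prod ((channelJoint v P T).map Prod.snd) := by
    conv_lhs => rw [channelJoint_eq_withDensity_prod hv hT hR]
    exact withDensity_absolutelyContinuous _ _
  rw [mutualInfo, klDiv, if_pos ⟨hac, (h_int1.sub h_int2).congr hllr.symm⟩,
    integral_congr_ae hllr, integral_sub h_int1 h_int2, integral_log_gaussianPDFReal_channelJoint hT,
    integral_log_outputPDF_channelJoint hv hT, sub_neg_eq_add]

end Channel

lemma sisoJoint_eq_channelJoint (v : ℝ≥0) (ν : Measure ℝ) :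
    sisoJoint v ν = channelJoint v ν (fun x => x) := rfl

lemma mutualInfo_sisoJoint {v : ℝ≥0} (hv : 0 < v) {ν : Measure ℝ} [IsProbabilityMeasure ν]
    {R : ℝ} (hν : ∀ᵐ x ∂ν, |x| ≤ R) :
    mutualInfo (sisoJoint v ν) =
      ((∫ z, log (gaussianPDFReal 0 v z) ∂(gaussianReal 0 v) +
        ∫ y, negMulLog (outputPDF v ν y) : ℝ) : EReal) := by
  have h : ν.map (fun x => x) = ν := Measure.map_id
  rw [sisoJoint_eq_channelJoint, mutualInfo_channelJoint hv measurable_id' (by rwa [h]), h]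

lemma mutualInfo_misoJoint {n : ℕ} (h : Fin n → ℝ) {v : ℝ≥0} (hv : 0 < v)
    {μ : Measure (Fin n → ℝ)} [IsProbabilityMeasure μ] {R : ℝ}
    (hμ : ∀ᵐ x ∂μ.map (fun x => ∑ k, h k * x k), |x| ≤ R) :
    mutualInfo (misoJoint h v μ) = mutualInfo (sisoJoint v (μ.map fun x => ∑ k, h k * x k)) := by
  have hT : Measurable (fun x : Fin n → ℝ => ∑ k, h k * x k) := by fun_prop
  have := Measure.isProbabilityMeasure_map (μ := μ) hT.aemeasurable
  rw [mutualInfo_sisoJoint hv hμ]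
  exact mutualInfo_channelJoint hv hT hμ

lemma integrable_negMulLog_outputPDF {v : ℝ≥0} (hv : 0 < v) {ν : Measure ℝ}
    [IsProbabilityMeasure ν] {R : ℝ} (hν : ∀ᵐ x ∂ν, |x| ≤ R) :
    Integrable (fun y => negMulLog (outputPDF v ν y)) := by
  have h : ν.map (fun x => x) = ν := Measure.map_id
  have hq := measurable_outputPDF v ν
  have h_int := integrable_log_outputPDF_channelJoint (P := ν) hv measurable_id' (by rwa [h])
  rw [h] at h_int
  have h_int' : Integrable (fun y => log (outputPDF v ν y))
      ((channelJoint v ν fun x => x).map Prod.snd) :=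
    (integrable_map_measure hq.log.aestronglyMeasurable measurable_snd.aemeasurable).2 h_int
  rw [channelJoint_map_snd hv measurable_id', h,
    integrable_withDensity_iff hq.ennreal_ofReal (by simp)] at h_int'
  refine h_int'.neg.congr (.of_forall fun y => ?_)
  simp [negMulLog, ENNReal.toReal_ofReal (outputPDF_nonneg _ _ _), mul_comm]

lemma outputPDF_map_const_sub (v : ℝ≥0) (ν : Measure ℝ) (c y : ℝ) :
    outputPDF v (ν.map fun x => c - x) y = outputPDF v ν (c - y) := by
  rw [outputPDF, integral_map (by fun_prop)
    (measurable_gaussianPDFReal_mean v y).aestronglyMeasurable, outputPDF]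
  refine integral_congr_ae (.of_forall fun x => ?_)
  simp only [gaussianPDFReal]
  congr 3
  ring

/-- The mixture of `ν` and its reflection about `c / 2`, in equal proportions. -/
def symmetrization (c : ℝ) (ν : Measure ℝ) : Measure ℝ :=
  (2⁻¹ : ℝ≥0∞) • ν + (2⁻¹ : ℝ≥0∞) • ν.map (fun x => c - x)

lemma isProbabilityMeasure_symmetrization (c : ℝ) (ν : Measure ℝ) [IsProbabilityMeasure ν] :
    IsProbabilityMeasure (symmetrization c ν) := by
  have := Measure.isProbabilityMeasure_map (μ := ν)
    (by fun_prop : AEMeasurable (fun x => c - x) ν)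
  constructor
  simp [symmetrization, ENNReal.inv_two_add_inv_two]

lemma ae_symmetrization {c : ℝ} {ν : Measure ℝ} (hν : ∀ᵐ x ∂ν, x ∈ Set.Icc 0 c) :
    ∀ᵐ x ∂symmetrization c ν, x ∈ Set.Icc 0 c := by
  rw [symmetrization, ae_add_measure_iff]
  refine ⟨Measure.ae_smul_measure hν _, Measure.ae_smul_measure ?_ _⟩
  refine (ae_map_iff (by fun_prop) measurableSet_Icc).2 ?_
  filter_upwards [hν] with x hx
  exact ⟨by linarith [hx.2], by linarith [hx.1]⟩

lemma integral_symmetrization {c : ℝ} {ν : Measure ℝ} {f : ℝ → ℝ} (hfm : Measurable f)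
    (hf : Integrable f ν) (hf' : Integrable (fun x => f (c - x)) ν) :
    ∫ x, f x ∂symmetrization c ν = 2⁻¹ * ∫ x, f x ∂ν + 2⁻¹ * ∫ x, f (c - x) ∂ν := by
  have hmap : Integrable f (ν.map fun x => c - x) :=
    (integrable_map_measure hfm.aestronglyMeasurable (by fun_prop)).2 hf'
  rw [symmetrization, integral_add_measure (hf.smul_measure (by simp))
    (hmap.smul_measure (by simp)), integral_smul_measure, integral_smul_measure,
    integral_map (by fun_prop) hfm.aestronglyMeasurable]
  simp

lemma abs_le_of_ae_mem_Icc {c : ℝ} {ν : Measure ℝ} (hν : ∀ᵐ x ∂ν, x ∈ Set.Icc 0 c) :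
    ∀ᵐ x ∂ν, |x| ≤ c :=
  hν.mono fun _ hx => (abs_of_nonneg hx.1).trans_le hx.2

lemma integral_id_symmetrization {c : ℝ} {ν : Measure ℝ} [IsProbabilityMeasure ν]
    (hν : ∀ᵐ x ∂ν, x ∈ Set.Icc 0 c) : ∫ x, x ∂symmetrization c ν = c / 2 := by
  have h_int : Integrable (fun x : ℝ => x) ν :=
    Integrable.of_bound (by fun_prop) c (abs_le_of_ae_mem_Icc hν)
  rw [integral_symmetrization measurable_id' h_int ((integrable_const c).sub h_int),
    integral_sub (integrable_const c) h_int]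
  simp
  ring

lemma outputPDF_symmetrization (v : ℝ≥0) (c : ℝ) (ν : Measure ℝ) [IsProbabilityMeasure ν]
    (y : ℝ) : outputPDF v (symmetrization c ν) y =
      2⁻¹ * outputPDF v ν y + 2⁻¹ * outputPDF v ν (c - y) := by
  have hm := measurable_gaussianPDFReal_mean v y
  have := Measure.isProbabilityMeasure_map (μ := ν)
    (by fun_prop : AEMeasurable (fun x => c - x) ν)
  have hmap := integrable_gaussianPDFReal_mean v (ν.map fun x => c - x) y
  rw [integrable_map_measure hm.aestronglyMeasurable (by fun_prop)] at hmap
  rw [← outputPDF_map_const_sub, outputPDF, integral_symmetrization hm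
    (integrable_gaussianPDFReal_mean v ν y) hmap, outputPDF, outputPDF,
    integral_map (by fun_prop) hm.aestronglyMeasurable]

lemma mutualInfo_sisoJoint_le_symmetrization {v : ℝ≥0} (hv : 0 < v) {c : ℝ} {ν : Measure ℝ}
    [IsProbabilityMeasure ν] (hν : ∀ᵐ x ∂ν, x ∈ Set.Icc 0 c) :
    mutualInfo (sisoJoint v ν) ≤ mutualInfo (sisoJoint v (symmetrization c ν)) := by
  have := isProbabilityMeasure_symmetrization c ν
  have hb := abs_le_of_ae_mem_Icc hν
  have hb' := abs_le_of_ae_mem_Icc (ae_symmetrization hν)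
  rw [mutualInfo_sisoJoint hv hb, mutualInfo_sisoJoint hv hb', EReal.coe_le_coe_iff]
  gcongr 1
  have h_int := integrable_negMulLog_outputPDF hv hb
  have h_int' := h_int.comp_sub_left c
  calc ∫ y, negMulLog (outputPDF v ν y)
      = ∫ y, (2⁻¹ * negMulLog (outputPDF v ν y) + 2⁻¹ * negMulLog (outputPDF v ν (c - y))) := by
        rw [integral_add (h_int.const_mul _) (h_int'.const_mul _), integral_const_mul,
          integral_const_mul,
          integral_sub_left_eq_self (fun y => negMulLog (outputPDF v ν y)) volume c]
        ring
    _ ≤ ∫ y, negMulLog (outputPDF v (symmetrization c ν) y) := by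
        refine integral_mono ((h_int.const_mul _).add (h_int'.const_mul _))
          (integrable_negMulLog_outputPDF hv hb') fun y => ?_
        rw [outputPDF_symmetrization]
        exact concaveOn_negMulLog.2 (outputPDF_nonneg v ν y) (outputPDF_nonneg v ν (c - y))
          (by norm_num) (by norm_num) (by norm_num)

lemma sCum_self {n : ℕ} (h : Fin n → ℝ) : sCum h n = ∑ k, h k :=
  Finset.sum_congr rfl fun i _ => if_pos i.2

end

theorem miso_capacity_peak_only (n : ℕ) (hn : 2 ≤ n) (h : Fin n → ℝ)
    (hord : ∀ i j : Fin n, i ≤ j → h j ≤ h i) (hpos : ∀ k, 0 < h k)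
    (v : ℝ≥0) (hv : 0 < v)
    (A α : ℝ) (hA : 0 < A) (hα1 : (n : ℝ) / 2 ≤ α) (hα2 : α ≤ n) :
    misoCapacity h v A (α * A)
      = sisoCapacity v (sCum h n * A) (sCum h n * A / 2) := by
  have : NeZero n := ⟨by lia⟩
  have hs : 0 < sCum h n := by
    rw [sCum_self]
    exact Finset.sum_pos (fun k _ => hpos k) Finset.univ_nonempty
  have hT : Measurable (fun x : Fin n → ℝ => ∑ k, h k * x k) := by fun_prop
  refine le_antisymm (iSup₂_le ?_) (iSup₂_le ?_)
  · rintro μ ⟨hμ, hμA, -⟩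
    have := Measure.isProbabilityMeasure_map (μ := μ) hT.aemeasurable
    have hν : ∀ᵐ s ∂μ.map (fun x => ∑ k, h k * x k), s ∈ Set.Icc 0 (sCum h n * A) := by
      refine (ae_map_iff hT.aemeasurable measurableSet_Icc).2 ?_
      filter_upwards [ae_all_iff.2 hμA] with x hx
      refine ⟨Finset.sum_nonneg fun k _ => mul_nonneg (hpos k).le (hx k).1, ?_⟩
      rw [sCum_self, Finset.sum_mul]
      exact Finset.sum_le_sum fun k _ => mul_le_mul_of_nonneg_left (hx k).2 (hpos k).le
    rw [mutualInfo_misoJoint h hv (abs_le_of_ae_mem_Icc hν)]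
    exact (mutualInfo_sisoJoint_le_symmetrization hv hν).trans (le_iSup₂_of_le _
      ⟨isProbabilityMeasure_symmetrization _ _, ae_symmetrization hν,
        (integral_id_symmetrization hν).le⟩ le_rfl)
  · rintro ν ⟨hν, hνA, hνE⟩
    have hD : Measurable (fun (s : ℝ) (_ : Fin n) => s / sCum h n) := by fun_prop
    have hprob := Measure.isProbabilityMeasure_map (μ := ν) hD.aemeasurable
    have hback : (ν.map fun (s : ℝ) (_ : Fin n) => s / sCum h n).map
        (fun x => ∑ k, h k * x k) = ν := by
      rw [Measure.map_map hT hD]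
      convert Measure.map_id
      funext s
      rw [Function.comp_apply, ← Finset.sum_mul, ← sCum_self, mul_div_cancel₀ _ hs.ne', id]
    have hMI := mutualInfo_misoJoint h hv (μ := ν.map fun s _ => s / sCum h n)
      (by rw [hback]; exact abs_le_of_ae_mem_Icc hνA)
    rw [hback] at hMI
    rw [← hMI]
    refine le_iSup₂_of_le _ ⟨hprob, fun k => ?_, ?_⟩ le_rfl
    · refine (ae_map_iff hD.aemeasurable (measurable_pi_apply k measurableSet_Icc)).2 ?_
      filter_upwards [hνA] with s hs'
      exact ⟨div_nonneg hs'.1 hs.le, (div_le_iff₀' hs).2 hs'.2⟩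
    · have hmean : ∀ k : Fin n, ∫ x, x k ∂(ν.map fun s _ => s / sCum h n) =
          (∫ s, s ∂ν) / sCum h n := fun k => by
        rw [integral_map hD.aemeasurable (measurable_pi_apply k).aestronglyMeasurable, integral_div]
      simp only [hmean, Finset.sum_const, Finset.card_univ, Fintype.card_fin, nsmul_eq_mul]
      calc (n : ℝ) * ((∫ s, s ∂ν) / sCum h n) ≤ n * (sCum h n * A / 2 / sCum h n) := by gcongr
        _ = n / 2 * A := by field_simp
        _ ≤ α * A := by gcongr
end

section
/- If α_th ≤ α < n/2, then the capacity is lower-bounded as C_{h,σ²}(A, αA) ≥ (1/2)·log(1 + s_n² A² / (2π e σ²)). -/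
open MeasureTheory ProbabilityTheory Real Filter
open scoped NNReal ENNReal Classical

section Channel

variable {E : Type*} [MeasurableSpace E]

/-- Joint law of the input and the output of the additive Gaussian channel with noise variance `v`
whose noiseless output is `m`. -/
noncomputable def channelLaw (m : E → ℝ) (v : ℝ≥0) (μ : Measure E) : Measure (E × ℝ) :=
  (μ.prod (gaussianReal 0 v)).map (fun p => (p.1, m p.1 + p.2))

/-- Lebesgue density of the output of the additive Gaussian channel. -/
noncomputable def outputDensity (m : E → ℝ) (v : ℝ≥0) (μ : Measure E) (y : ℝ) : ℝ≥0∞ :=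
  ∫⁻ x, gaussianPDF (m x) v y ∂μ

variable {m : E → ℝ} {v : ℝ≥0} {μ : Measure E}

lemma measurable_channelDensity (hm : Measurable m) :
    Measurable (fun p : E × ℝ => gaussianPDF (m p.1) v p.2) :=
  measurable_uncurry_gaussianPDF.comp
    ((hm.comp measurable_fst).prodMk (measurable_const.prodMk measurable_snd))

lemma measurable_channelDensity_left (hm : Measurable m) (y : ℝ) :
    Measurable (fun x : E => gaussianPDF (m x) v y) :=
  measurable_uncurry_gaussianPDF.comp (hm.prodMk (measurable_const.prodMk measurable_const))

lemma measurable_outputDensity [SFinite μ] (hm : Measurable m) :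
    Measurable (outputDensity m v μ) :=
  (measurable_channelDensity hm).lintegral_prod_left

lemma channelLaw_eq_withDensity [SFinite μ] (hm : Measurable m) (hv : v ≠ 0) :
    channelLaw m v μ = (μ.prod volume).withDensity (fun p => gaussianPDF (m p.1) v p.2) := by
  have hD := measurable_channelDensity (v := v) hm
  refine Measure.ext_of_lintegral _ fun g hg => ?_
  rw [channelLaw, lintegral_map hg (by fun_prop), lintegral_prod _ (by fun_prop),
    lintegral_withDensity_eq_lintegral_mul _ hD hg, lintegral_prod _ (hD.mul hg).aemeasurable]
  refine lintegral_congr fun x => ?_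
  have h1 : ∫⁻ z, g (x, m x + z) ∂gaussianReal 0 v = ∫⁻ y, g (x, y) ∂gaussianReal (m x) v := by
    rw [← zero_add (m x), ← gaussianReal_map_const_add, lintegral_map (by fun_prop) (by fun_prop)]
    simp
  rw [h1, gaussianReal_of_var_ne_zero _ hv,
    lintegral_withDensity_eq_lintegral_mul _ (measurable_gaussianPDF _ _) (by fun_prop)]
  rfl

lemma channelLaw_map_fst [SFinite μ] (hm : Measurable m) : (channelLaw m v μ).map Prod.fst = μ := by
  rw [channelLaw, Measure.map_map (by fun_prop) (by fun_prop)]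
  exact (Measure.map_fst_prod (μ := μ) (ν := gaussianReal 0 v)).trans (by simp)

lemma channelLaw_map_snd [SFinite μ] (hm : Measurable m) (hv : v ≠ 0) :
    (channelLaw m v μ).map Prod.snd = volume.withDensity (outputDensity m v μ) := by
  have hD := measurable_channelDensity (v := v) hm
  refine Measure.ext_of_lintegral _ fun g hg => ?_
  rw [lintegral_map hg measurable_snd, channelLaw_eq_withDensity hm hv,
    lintegral_withDensity_eq_lintegral_mul _ hD (by fun_prop),
    lintegral_prod_symm' _ (hD.mul (by fun_prop)),
    lintegral_withDensity_eq_lintegral_mul _ (measurable_outputDensity hm) hg]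
  refine lintegral_congr fun y => ?_
  exact lintegral_mul_const (g y) (measurable_channelDensity_left hm y)

lemma outputDensity_ne_zero [NeZero μ] (hm : Measurable m) (hv : v ≠ 0) (y : ℝ) :
    outputDensity m v μ y ≠ 0 := by
  intro h
  rw [outputDensity, lintegral_eq_zero_iff (measurable_channelDensity_left hm y)] at h
  have h' : ∀ᵐ x ∂μ, False := h.mono fun x hx => (gaussianPDF_pos (m x) hv y).ne' hx
  rw [Filter.eventually_false_iff_eq_bot, ae_eq_bot] at h'
  exact NeZero.ne μ h'

lemma gaussianPDF_le (a : ℝ) (v : ℝ≥0) (y : ℝ) :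
    gaussianPDF a v y ≤ ENNReal.ofReal (√(2 * π * v))⁻¹ := by
  refine ENNReal.ofReal_le_ofReal ?_
  rw [gaussianPDFReal]
  refine mul_le_of_le_one_right (by positivity) (Real.exp_le_one_iff.2 ?_)
  rw [neg_div]
  exact neg_nonpos.2 (by positivity)

lemma outputDensity_ne_top [IsFiniteMeasure μ] (y : ℝ) : outputDensity m v μ y ≠ ∞ := by
  refine ne_top_of_le_ne_top ?_ (lintegral_mono fun x => gaussianPDF_le (m x) v y)
  simp [ENNReal.mul_eq_top]

lemma lintegral_outputDensity [IsProbabilityMeasure μ] (hm : Measurable m) (hv : v ≠ 0) :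
    ∫⁻ y, outputDensity m v μ y = 1 := by
  simp only [outputDensity]
  rw [lintegral_lintegral_swap (f := fun y x => gaussianPDF (m x) v y)]
  · simp [lintegral_gaussianPDF_eq_one _ hv]
  · exact ((measurable_channelDensity hm).comp measurable_swap).aemeasurable

/-- The information density of the additive Gaussian channel. -/
lemma llr_channelLaw [IsProbabilityMeasure μ] (hm : Measurable m) (hv : v ≠ 0) :
    llr (channelLaw m v μ)
        (((channelLaw m v μ).map Prod.fst).prod ((channelLaw m v μ).map Prod.snd))
      =ᵐ[channelLaw m v μ]
        fun p => log (gaussianPDFReal (m p.1) v p.2 / (outputDensity m v μ p.2).toReal) := by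
  have hD := measurable_channelDensity (v := v) hm
  have hf := measurable_outputDensity (v := v) (μ := μ) hm
  set Q := ((channelLaw m v μ).map Prod.fst).prod ((channelLaw m v μ).map Prod.snd) with hQ
  have hfin : IsFiniteMeasure (volume.withDensity (outputDensity m v μ)) :=
    isFiniteMeasure_withDensity (by simp [lintegral_outputDensity hm hv])
  have hQ' : Q = (μ.prod volume).withDensity (fun p => outputDensity m v μ p.2) := by
    rw [hQ, channelLaw_map_fst hm, channelLaw_map_snd hm hv, prod_withDensity_right hf]
  have hPQ : channelLaw m v μ
      = Q.withDensity (fun p => gaussianPDF (m p.1) v p.2 / outputDensity m v μ p.2) := by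
    rw [hQ', ← withDensity_mul _ (by fun_prop) (by fun_prop), channelLaw_eq_withDensity hm hv]
    congr 1
    ext p
    exact (ENNReal.mul_div_cancel (outputDensity_ne_zero hm hv _) (outputDensity_ne_top _)).symm
  have hac : channelLaw m v μ ≪ Q := by
    rw [hPQ]; exact withDensity_absolutelyContinuous _ _
  have hsf : SigmaFinite Q := by
    rw [hQ, channelLaw_map_fst hm, channelLaw_map_snd hm hv]
    infer_instance
  have hr := Measure.rnDeriv_withDensity Q
    (f := fun p => gaussianPDF (m p.1) v p.2 / outputDensity m v μ p.2) (by fun_prop)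
  rw [← hPQ] at hr
  filter_upwards [hac.ae_le hr] with p hp
  simp only [llr_def, hp]
  simp [ENNReal.toReal_div]

lemma le_mutualInfo_channelLaw [IsProbabilityMeasure μ] (hm : Measurable m) (hv : v ≠ 0) {B : ℝ}
    (hB : Integrable (fun p => log (gaussianPDFReal (m p.1) v p.2
        / (outputDensity m v μ p.2).toReal)) (channelLaw m v μ) →
      B ≤ ∫ p, log (gaussianPDFReal (m p.1) v p.2 / (outputDensity m v μ p.2).toReal)
        ∂channelLaw m v μ) :
    (B : EReal) ≤ mutualInfo (channelLaw m v μ) := by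
  have hllr := llr_channelLaw (μ := μ) hm hv
  rw [mutualInfo, klDiv]
  split_ifs with h
  · rw [integral_congr_ae hllr]
    exact EReal.coe_le_coe_iff.2 (hB ((integrable_congr hllr).1 h.2))
  · exact le_top

end Channel

section EntropyPower

lemma hasDerivAt_cdf_stdGaussian (x : ℝ) :
    HasDerivAt (cdf (gaussianReal 0 1)) (gaussianPDFReal 0 1 x) x := by
  have hg_int := integrable_gaussianPDFReal 0 1
  have hcont : Continuous (gaussianPDFReal 0 1) := by
    unfold gaussianPDFReal
    fun_prop
  have hcdf : ∀ y, cdf (gaussianReal 0 1) y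
      = (∫ t in Set.Iic 0, gaussianPDFReal 0 1 t) + ∫ t in (0 : ℝ)..y, gaussianPDFReal 0 1 t := by
    intro y
    rw [← intervalIntegral.integral_Iic_sub_Iic hg_int.integrableOn hg_int.integrableOn,
      add_sub_cancel, cdf_eq_real, Measure.real,
      gaussianReal_apply_eq_integral _ one_ne_zero,
      ENNReal.toReal_ofReal (setIntegral_nonneg measurableSet_Iic
        fun t _ => gaussianPDFReal_nonneg _ _ _)]
  rw [funext hcdf]
  exact (intervalIntegral.integral_hasDerivAt_right (hcont.intervalIntegrable _ _)
    (hcont.stronglyMeasurableAtFilter _ _) hcont.continuousAt).const_add _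

lemma log_stdGaussianPDFReal (x : ℝ) :
    log (gaussianPDFReal 0 1 x) = -(x ^ 2 / 2) - log (2 * π) / 2 := by
  rw [gaussianPDFReal, Real.log_mul (by positivity) (by positivity), Real.log_inv, Real.log_exp,
    Real.log_sqrt (by positivity)]
  simp
  ring

lemma integral_sq_stdGaussian : ∫ x, x ^ 2 ∂gaussianReal 0 1 = 1 := by
  have h := variance_fun_id_gaussianReal (μ := 0) (v := 1)
  rw [variance_eq_integral (by fun_prop)] at h
  simpa using h

lemma integrable_sq_stdGaussian : Integrable (fun x : ℝ => x ^ 2) (gaussianReal 0 1) :=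
  (memLp_id_gaussianReal 2).integrable_sq

lemma integrable_id_stdGaussian : Integrable (fun x : ℝ => x) (gaussianReal 0 1) :=
  memLp_one_iff_integrable.1 (memLp_id_gaussianReal 1)

lemma integrable_quadratic_stdGaussian_prod (p q r : ℝ) :
    Integrable (fun z : ℝ × ℝ => p * z.1 ^ 2 + q * (z.1 * z.2) + r * z.2 ^ 2)
      ((gaussianReal 0 1).prod (gaussianReal 0 1)) :=
  (((integrable_sq_stdGaussian.comp_fst _).const_mul p).add
    ((integrable_id_stdGaussian.mul_prod integrable_id_stdGaussian).const_mul q)).add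
    ((integrable_sq_stdGaussian.comp_snd _).const_mul r)

lemma integral_quadratic_stdGaussian_prod (p q r : ℝ) :
    ∫ z : ℝ × ℝ, p * z.1 ^ 2 + q * (z.1 * z.2) + r * z.2 ^ 2
      ∂((gaussianReal 0 1).prod (gaussianReal 0 1)) = p + r := by
  have h1 := (integrable_sq_stdGaussian.comp_fst (gaussianReal 0 1)).const_mul p
  have h2 := (integrable_id_stdGaussian.mul_prod integrable_id_stdGaussian).const_mul q
  have h3 := (integrable_sq_stdGaussian.comp_snd (gaussianReal 0 1)).const_mul r
  rw [integral_add (by exact h1.add h2) h3, integral_add h1 h2, integral_const_mul, integral_const_mul,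
    integral_const_mul, integral_fun_fst (fun x : ℝ => x ^ 2),
    integral_fun_snd (fun x : ℝ => x ^ 2), integral_prod_mul (fun x : ℝ => x) (fun x : ℝ => x),
    integral_sq_stdGaussian]
  simp

/-- The standard Gaussian measure on the plane is invariant under rotations. -/
lemma map_rotation_stdGaussian_prod {c s : ℝ} (hs : 0 ≤ s) (hcs : c ^ 2 + s ^ 2 = 1) :
    ((gaussianReal 0 1).prod (gaussianReal 0 1)).map
        (fun z : ℝ × ℝ => (c * z.1 - s * z.2, s * z.1 + c * z.2))
      = (gaussianReal 0 1).prod (gaussianReal 0 1) := by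
  have hc : |c| ≤ 1 := abs_le_one_iff_mul_self_le_one.2 (by nlinarith)
  have hcos : Real.cos (-Real.arccos c) = c := by
    rw [Real.cos_neg, Real.cos_arccos (abs_le.1 hc).1 (abs_le.1 hc).2]
  have hsin : Real.sin (-Real.arccos c) = -s := by
    rw [Real.sin_neg, Real.sin_arccos, ← hcs, add_sub_cancel_left, Real.sqrt_sq hs]
  have h := IsGaussian.map_rotation_eq_self_of_forall_strongDual_eq_zero (μ := gaussianReal 0 1)
    (fun L => by simp [integral_continuousLinearMap_gaussianReal]) (-Real.arccos c)
  convert h using 2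
  ext z
  · simp [ContinuousLinearMap.rotation_apply, hcos, hsin, sub_eq_add_neg]
  · simp [ContinuousLinearMap.rotation_apply, hcos, hsin]

lemma lintegral_deriv_mul_comp_le {Θ Θ' : ℝ → ℝ} (hΘ : ∀ x, HasDerivAt Θ (Θ' x) x)
    (hpos : ∀ x, 0 ≤ Θ' x) (f : ℝ → ℝ≥0∞) :
    ∫⁻ x, ENNReal.ofReal (Θ' x) * f (Θ x) ≤ ∫⁻ y, f y := by
  have hmono : Monotone Θ := monotone_of_hasDerivAt_nonneg hΘ hpos
  rw [← setLIntegral_univ, ← lintegral_image_eq_lintegral_deriv_mul_of_monotoneOn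
    MeasurableSet.univ (fun x _ => (hΘ x).hasDerivWithinAt) (hmono.monotoneOn _)]
  exact setLIntegral_le_lintegral _ _

variable {L τ c s : ℝ} {f : ℝ → ℝ≥0∞}

/-- The output `L Φ(G₁) + τ G₂` in the rotated coordinates `z` of the Gaussian pair `(G₁, G₂)`. -/
noncomputable def rotatedOutput (L τ c s : ℝ) (z : ℝ × ℝ) : ℝ :=
  L * cdf (gaussianReal 0 1) (c * z.1 - s * z.2) + τ * (s * z.1 + c * z.2)

/-- Derivative of `rotatedOutput` in the first coordinate. -/
noncomputable def rotatedOutputDeriv (L τ c s : ℝ) (z : ℝ × ℝ) : ℝ :=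
  L * (gaussianPDFReal 0 1 (c * z.1 - s * z.2) * c) + τ * s

lemma hasDerivAt_rotatedOutput (w x : ℝ) :
    HasDerivAt (fun x => rotatedOutput L τ c s (x, w)) (rotatedOutputDeriv L τ c s (x, w)) x := by
  have h1 : HasDerivAt (fun x => c * x - s * w) c x := by
    simpa using ((hasDerivAt_id x).const_mul c).sub_const (s * w)
  have h2 : HasDerivAt (fun x => s * x + c * w) s x := by
    simpa using ((hasDerivAt_id x).const_mul s).add_const (c * w)
  exact (((hasDerivAt_cdf_stdGaussian (c * x - s * w)).comp x h1).const_mul L).add (h2.const_mul τ)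

lemma rotatedOutputDeriv_pos (hL : 0 < L) (hτ : 0 < τ) (hc : 0 < c) (hs : 0 < s) (z : ℝ × ℝ) :
    0 < rotatedOutputDeriv L τ c s z := by
  have := gaussianPDFReal_pos 0 1 (c * z.1 - s * z.2) one_ne_zero
  rw [rotatedOutputDeriv]
  positivity

lemma measurable_rotatedOutput : Measurable (rotatedOutput L τ c s) := by
  have h : Measurable (cdf (gaussianReal 0 1)) := (monotone_cdf _).measurable
  unfold rotatedOutput
  fun_prop

lemma measurable_rotatedOutputDeriv : Measurable (rotatedOutputDeriv L τ c s) := by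
  have h := measurable_gaussianPDFReal 0 1
  unfold rotatedOutputDeriv
  fun_prop

/-- The ratio of a candidate output density to the conditional output density given the second
rotated coordinate. -/
noncomputable def densityRatio (L τ c s : ℝ) (f : ℝ → ℝ≥0∞) (z : ℝ × ℝ) : ℝ :=
  (f (rotatedOutput L τ c s z)).toReal * rotatedOutputDeriv L τ c s z / gaussianPDFReal 0 1 z.1

lemma densityRatio_nonneg (hL : 0 < L) (hτ : 0 < τ) (hc : 0 < c) (hs : 0 < s) (z : ℝ × ℝ) :
    0 ≤ densityRatio L τ c s f z := by
  have h1 := gaussianPDFReal_nonneg 0 1 z.1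
  have h2 := (rotatedOutputDeriv_pos hL hτ hc hs z).le
  rw [densityRatio]
  positivity

lemma measurable_densityRatio (hf : Measurable f) : Measurable (densityRatio L τ c s f) := by
  have h1 := measurable_gaussianPDFReal 0 1
  have h2 := measurable_rotatedOutput (L := L) (τ := τ) (c := c) (s := s)
  have h3 := measurable_rotatedOutputDeriv (L := L) (τ := τ) (c := c) (s := s)
  unfold densityRatio
  fun_prop

lemma lintegral_densityRatio_le (hL : 0 < L) (hτ : 0 < τ) (hc : 0 < c) (hs : 0 < s)
    (hf : Measurable f) (hf_top : ∀ y, f y ≠ ∞) (hf_one : ∫⁻ y, f y ≤ 1) :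
    ∫⁻ z, ENNReal.ofReal (densityRatio L τ c s f z)
      ∂((gaussianReal 0 1).prod (gaussianReal 0 1)) ≤ 1 := by
  have hR : Measurable (densityRatio L τ c s f) := measurable_densityRatio hf
  rw [lintegral_prod_symm _ hR.ennreal_ofReal.aemeasurable]
  have hinner : ∀ w, ∫⁻ x, ENNReal.ofReal (densityRatio L τ c s f (x, w)) ∂gaussianReal 0 1 ≤ 1 := by
    intro w
    have hRw : Measurable fun x => densityRatio L τ c s f (x, w) := hR.comp measurable_prodMk_right
    rw [gaussianReal_of_var_ne_zero _ one_ne_zero, lintegral_withDensity_eq_lintegral_mul _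
      (measurable_gaussianPDF _ _) hRw.ennreal_ofReal]
    refine le_trans (le_of_eq (lintegral_congr fun x => ?_)) ((lintegral_deriv_mul_comp_le
      (hasDerivAt_rotatedOutput (L := L) (τ := τ) (c := c) (s := s) w)
      (fun x => (rotatedOutputDeriv_pos hL hτ hc hs (x, w)).le) f).trans hf_one)
    have hφ := gaussianPDFReal_pos 0 1 x one_ne_zero
    have hd := (rotatedOutputDeriv_pos hL hτ hc hs (x, w)).le
    simp only [Pi.mul_apply, gaussianPDF]
    rw [← ENNReal.ofReal_mul hφ.le, densityRatio, mul_div_cancel₀ _ hφ.ne', mul_comm,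
      ENNReal.ofReal_mul hd, ENNReal.ofReal_toReal (hf_top _)]
  calc _ ≤ ∫⁻ _, 1 ∂gaussianReal 0 1 := lintegral_mono hinner
    _ = 1 := by simp

lemma integrable_densityRatio (hL : 0 < L) (hτ : 0 < τ) (hc : 0 < c) (hs : 0 < s)
    (hf : Measurable f) (hf_top : ∀ y, f y ≠ ∞) (hf_one : ∫⁻ y, f y ≤ 1) :
    Integrable (densityRatio L τ c s f) ((gaussianReal 0 1).prod (gaussianReal 0 1)) := by
  refine ⟨(measurable_densityRatio hf).aestronglyMeasurable, ?_⟩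
  rw [hasFiniteIntegral_iff_ofReal (ae_of_all _ (densityRatio_nonneg hL hτ hc hs))]
  exact (lintegral_densityRatio_le hL hτ hc hs hf hf_top hf_one).trans_lt ENNReal.one_lt_top

lemma integral_densityRatio_le (hL : 0 < L) (hτ : 0 < τ) (hc : 0 < c) (hs : 0 < s)
    (hf : Measurable f) (hf_top : ∀ y, f y ≠ ∞) (hf_one : ∫⁻ y, f y ≤ 1) :
    ∫ z, densityRatio L τ c s f z ∂((gaussianReal 0 1).prod (gaussianReal 0 1)) ≤ 1 := by
  rw [integral_eq_lintegral_of_nonneg_ae (ae_of_all _ (densityRatio_nonneg hL hτ hc hs))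
    (measurable_densityRatio hf).aestronglyMeasurable]
  exact ENNReal.toReal_le_of_le_ofReal zero_le_one
    (by simpa using lintegral_densityRatio_le hL hτ hc hs hf hf_top hf_one)

lemma le_log_rotatedOutputDeriv (hL : 0 < L) (hτ : 0 < τ) (hc : 0 < c) (hs : 0 < s)
    (hcs : c ^ 2 + s ^ 2 = 1) (z : ℝ × ℝ) :
    c ^ 2 * (log L - log c - (c * z.1 - s * z.2) ^ 2 / 2 - log (2 * π) / 2)
      + s ^ 2 * (log τ - log s) ≤ log (rotatedOutputDeriv L τ c s z) := by
  have hφ := gaussianPDFReal_pos 0 1 (c * z.1 - s * z.2) one_ne_zero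
  have h := strictConcaveOn_log_Ioi.concaveOn.2
    (show L * gaussianPDFReal 0 1 (c * z.1 - s * z.2) / c ∈ Set.Ioi 0 from
      div_pos (mul_pos hL hφ) hc)
    (show τ / s ∈ Set.Ioi 0 from div_pos hτ hs) (sq_nonneg c) (sq_nonneg s) hcs
  simp only [smul_eq_mul] at h
  rw [Real.log_div (mul_pos hL hφ).ne' hc.ne', Real.log_mul hL.ne' hφ.ne', log_stdGaussianPDFReal,
    Real.log_div hτ.ne' hs.ne'] at h
  have he : c ^ 2 * (L * gaussianPDFReal 0 1 (c * z.1 - s * z.2) / c) + s ^ 2 * (τ / s)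
      = rotatedOutputDeriv L τ c s z := by
    rw [rotatedOutputDeriv]
    field_simp
  rw [he] at h
  linarith

lemma le_neg_log_density (hL : 0 < L) (hτ : 0 < τ) (hc : 0 < c) (hs : 0 < s)
    (hcs : c ^ 2 + s ^ 2 = 1) (hf_zero : ∀ y, f y ≠ 0) (hf_top : ∀ y, f y ≠ ∞) (z : ℝ × ℝ) :
    c ^ 2 * (log L - log c - (c * z.1 - s * z.2) ^ 2 / 2 - log (2 * π) / 2)
      + s ^ 2 * (log τ - log s) + z.1 ^ 2 / 2 + log (2 * π) / 2 + 1 - densityRatio L τ c s f z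
      ≤ -log (f (rotatedOutput L τ c s z)).toReal := by
  have hφ := gaussianPDFReal_pos 0 1 z.1 one_ne_zero
  have hd := rotatedOutputDeriv_pos hL hτ hc hs z
  have ht := ENNReal.toReal_pos (hf_zero (rotatedOutput L τ c s z)) (hf_top _)
  have h1 := le_log_rotatedOutputDeriv hL hτ hc hs hcs z
  have h2 := Real.log_le_sub_one_of_pos (div_pos (mul_pos ht hd) hφ)
  rw [Real.log_div (mul_pos ht hd).ne' hφ.ne', Real.log_mul ht.ne' hd.ne',
    log_stdGaussianPDFReal] at h2
  rw [densityRatio]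
  linarith

/-- Entropy power inequality for the sum of a uniform variable on `[0, L]` and a Gaussian variable
of standard deviation `τ`, in information form. -/
lemma entropyPower_le_integral {S : ℝ} (hL : 0 < L) (hτ : 0 < τ) (hc : 0 < c) (hs : 0 < s)
    (hcs : c ^ 2 + s ^ 2 = 1) (hS : 0 < S) (hLS : L ^ 2 = 2 * π * Real.exp 1 * (c ^ 2 * S))
    (hτS : τ ^ 2 = s ^ 2 * S)
    (hf : Measurable f) (hf_zero : ∀ y, f y ≠ 0) (hf_top : ∀ y, f y ≠ ∞) (hf_one : ∫⁻ y, f y ≤ 1)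
    (hg_int : Integrable (fun z : ℝ × ℝ => -(z.2 ^ 2 / 2) - log (2 * π * τ ^ 2) / 2
        - log (f (L * cdf (gaussianReal 0 1) z.1 + τ * z.2)).toReal)
      ((gaussianReal 0 1).prod (gaussianReal 0 1))) :
    (log S - log (τ ^ 2)) / 2 ≤
      ∫ z : ℝ × ℝ, -(z.2 ^ 2 / 2) - log (2 * π * τ ^ 2) / 2
        - log (f (L * cdf (gaussianReal 0 1) z.1 + τ * z.2)).toReal
      ∂((gaussianReal 0 1).prod (gaussianReal 0 1)) := by
  have hrot := map_rotation_stdGaussian_prod hs.le hcs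
  have hmeas : Measurable fun z : ℝ × ℝ => (c * z.1 - s * z.2, s * z.1 + c * z.2) := by fun_prop
  rw [← hrot] at hg_int ⊢
  have hg_int' := hg_int.comp_measurable hmeas
  rw [integral_map hmeas.aemeasurable hg_int.aestronglyMeasurable]
  have hR := integrable_densityRatio hL hτ hc hs hf hf_top hf_one
  have hR' := integral_densityRatio_le hL hτ hc hs hf hf_top hf_one
  set k : ℝ := c ^ 2 * (log L - log c - log (2 * π) / 2) + s ^ 2 * (log τ - log s)
    + log (2 * π) / 2 + 1 - log (2 * π * τ ^ 2) / 2 with hk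
  set p : ℝ := -(s ^ 2 / 2) + 1 / 2 - c ^ 4 / 2 with hp
  set q : ℝ := -(s * c) + c ^ 3 * s with hq
  set r : ℝ := -(c ^ 2 / 2) - c ^ 2 * s ^ 2 / 2 with hr
  have hquad := integrable_quadratic_stdGaussian_prod p q r
  have hlow : Integrable (fun z : ℝ × ℝ => (p * z.1 ^ 2 + q * (z.1 * z.2) + r * z.2 ^ 2) + k
      - densityRatio L τ c s f z) ((gaussianReal 0 1).prod (gaussianReal 0 1)) :=
    (hquad.add (integrable_const k)).sub hR
  refine le_trans ?_ (integral_mono hlow hg_int' fun z => ?_)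
  · rw [integral_sub (by exact hquad.add (integrable_const k)) hR,
      integral_add hquad (integrable_const k), integral_quadratic_stdGaussian_prod]
    have hlogL : 2 * log L = log (2 * π) + 1 + 2 * log c + log S := by
      have := congrArg log hLS
      rw [Real.log_mul (by positivity) (by positivity), Real.log_mul (by positivity) (by positivity),
        Real.log_mul (by positivity) hS.ne', Real.log_exp, Real.log_pow, Real.log_pow] at this
      push_cast at this
      linarith
    have hlogτ : 2 * log τ = 2 * log s + log S := by
      have := congrArg log hτS
      rw [Real.log_mul (by positivity) hS.ne', Real.log_pow, Real.log_pow] at this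
      push_cast at this
      linarith
    have hpr : p + r = -(c ^ 2 / 2) := by
      rw [hp, hr]
      linear_combination (-(1 / 2) - c ^ 2 / 2) * hcs
    have hk' : k = c ^ 2 / 2 + log S / 2 + 1 - log (τ ^ 2) / 2 := by
      rw [hk, Real.log_mul (x := 2 * π) (y := τ ^ 2) (by positivity) (by positivity)]
      linear_combination (c ^ 2 / 2) * hlogL + (s ^ 2 / 2) * hlogτ + (log S / 2) * hcs
    rw [hpr, hk']
    simp only [integral_const, probReal_univ, one_smul]
    linarith
  · have h := le_neg_log_density hL hτ hc hs hcs hf_zero hf_top z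
    rw [rotatedOutput] at h
    refine le_trans (le_of_eq ?_) (sub_le_sub_right h
      ((s * z.1 + c * z.2) ^ 2 / 2 + log (2 * π * τ ^ 2) / 2) |>.trans (le_of_eq ?_))
    · rw [hk, hp, hq, hr]
      ring
    · ring

end EntropyPower

section Input

lemma integrable_min_mul_cdf (L b : ℝ) (ν : Measure ℝ) [IsFiniteMeasure ν] :
    Integrable (fun g => min (L * cdf (gaussianReal 0 1) g) b) ν := by
  have hmeas : Measurable (cdf (gaussianReal 0 1)) := (monotone_cdf _).measurable
  refine Integrable.of_bound (by fun_prop) (|L| + |b|) (ae_of_all _ fun g => ?_)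
  have h0 := cdf_nonneg (gaussianReal 0 1) g
  have h1 := cdf_le_one (gaussianReal 0 1) g
  have hL : |L * cdf (gaussianReal 0 1) g| ≤ |L| := by
    rw [abs_mul, abs_of_nonneg h0]
    exact mul_le_of_le_one_right (abs_nonneg _) h1
  rw [Real.norm_eq_abs]
  rcases min_choice (L * cdf (gaussianReal 0 1) g) b with h | h <;> rw [h]
  · linarith [abs_nonneg b]
  · linarith [abs_nonneg L]

lemma intervalIntegral_min_mul {L b : ℝ} (hL : 0 < L) (hb : 0 ≤ b) (hbL : b ≤ L) :
    ∫ r in (0 : ℝ)..1, min (L * r) b = b - b ^ 2 / (2 * L) := by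
  have hc : Continuous fun r : ℝ => min (L * r) b := by fun_prop
  have h0 : 0 ≤ b / L := by positivity
  have h1 : b / L ≤ 1 := (div_le_one hL).2 hbL
  have hleft : ∫ r in (0 : ℝ)..(b / L), min (L * r) b = ∫ r in (0 : ℝ)..(b / L), L * r := by
    refine intervalIntegral.integral_congr fun r hr => min_eq_left ?_
    rw [Set.uIcc_of_le h0] at hr
    rw [mul_comm]
    exact (le_div_iff₀ hL).1 hr.2
  have hright : ∫ r in (b / L)..1, min (L * r) b = ∫ r in (b / L)..1, b := by
    refine intervalIntegral.integral_congr fun r hr => min_eq_right ?_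
    rw [Set.uIcc_of_le h1] at hr
    rw [mul_comm]
    exact (div_le_iff₀ hL).1 hr.1
  rw [← intervalIntegral.integral_add_adjacent_intervals (hc.intervalIntegrable 0 (b / L))
    (hc.intervalIntegrable (b / L) 1), hleft, hright, intervalIntegral.integral_const_mul,
    integral_id, intervalIntegral.integral_const, smul_eq_mul]
  field_simp
  ring

/-- Truncated mean of the uniform variable `L Φ(G)` on `[0, L]`. -/
lemma integral_min_mul_cdf {L b : ℝ} (hL : 0 < L) (hb : 0 ≤ b) (hbL : b ≤ L) :
    ∫ g, min (L * cdf (gaussianReal 0 1) g) b ∂gaussianReal 0 1 = b - b ^ 2 / (2 * L) := by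
  have hc : Continuous fun r : ℝ => min (L * r) b := by fun_prop
  set H : ℝ → ℝ := fun t => ∫ r in (0 : ℝ)..t, min (L * r) b with hH
  have hHd : ∀ t, HasDerivAt H (min (L * t) b) t := fun t =>
    intervalIntegral.integral_hasDerivAt_right (hc.intervalIntegrable _ _)
      (hc.stronglyMeasurableAtFilter _ _) hc.continuousAt
  have hHc : Continuous H := continuous_iff_continuousAt.2 fun t => (hHd t).continuousAt
  have hg_int := integrable_min_mul_cdf L b (gaussianReal 0 1)
  rw [gaussianReal_of_var_ne_zero _ one_ne_zero, integrable_withDensity_iff_integrable_smul'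
    (measurable_gaussianPDF _ _) (ae_of_all _ fun _ => gaussianPDF_lt_top)] at hg_int
  simp only [toReal_gaussianPDF, smul_eq_mul, ← gaussianReal_of_var_ne_zero 0 one_ne_zero] at hg_int
  rw [integral_gaussianReal_eq_integral_smul one_ne_zero]
  simp only [smul_eq_mul]
  rw [integral_of_hasDerivAt_of_tendsto (f := fun g => H (cdf (gaussianReal 0 1) g))
    (fun x => ?_) hg_int ((hHc.tendsto 0).comp (tendsto_cdf_atBot _))
    ((hHc.tendsto 1).comp (tendsto_cdf_atTop _))]
  · simp [hH, intervalIntegral_min_mul hL hb hbL]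
  · rw [mul_comm]
    exact (hHd _).comp x (hasDerivAt_cdf_stdGaussian x)

variable {n : ℕ} {h : Fin n → ℝ}

lemma sCum_zero (h : Fin n → ℝ) : sCum h 0 = 0 := by simp [sCum]

lemma sCum_succ (h : Fin n → ℝ) (k : Fin n) : sCum h (k.val + 1) = sCum h k.val + h k := by
  have : h k = ∑ i : Fin n, if i = k then h i else 0 := by simp
  rw [sCum, sCum, this, ← Finset.sum_add_distrib]
  refine Finset.sum_congr rfl fun i _ => ?_
  rcases lt_trichotomy i k with hik | rfl | hik
  · have : i.val < k.val := hik
    simp [hik.ne, this, this.trans (Nat.lt_succ_self _)]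
  · simp
  · have : k.val < i.val := hik
    simp [hik.ne', this.not_gt, Nat.not_lt.2 (Nat.succ_le_of_lt this)]

lemma sCum_mono (hpos : ∀ k, 0 < h k) : Monotone (sCum h) := by
  intro a b hab
  refine Finset.sum_le_sum fun i _ => ?_
  split_ifs with h1 h2
  · rfl
  · exact absurd (h1.trans_le hab) h2
  · exact (hpos i).le
  · rfl

lemma sCum_nonneg (hpos : ∀ k, 0 < h k) (k : ℕ) : 0 ≤ sCum h k :=
  (sCum_zero h).symm.le.trans (sCum_mono hpos (Nat.zero_le k))

lemma sCum_pos (hn : 0 < n) (hpos : ∀ k, 0 < h k) : 0 < sCum h n := by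
  refine Finset.sum_pos (fun i _ => ?_) ⟨⟨0, hn⟩, Finset.mem_univ _⟩
  simpa using hpos i

lemma sum_fin_telescope (n : ℕ) (F : ℕ → ℝ) :
    ∑ k : Fin n, (F (k.val + 1) - F k.val) = F n - F 0 := by
  rw [Fin.sum_univ_eq_sum_range (fun k => F (k + 1) - F k), Finset.sum_range_sub]

/-- Minimal-power input of the LEDs producing the noiseless output `u`: the LEDs are switched to
full power one after the other, the strongest first. -/
noncomputable def fillInput (h : Fin n → ℝ) (A u : ℝ) (k : Fin n) : ℝ :=
  (min u (sCum h (k.val + 1) * A) - min u (sCum h k.val * A)) / h k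

lemma measurable_fillInput (h : Fin n → ℝ) (A : ℝ) : Measurable (fillInput h A) := by
  unfold fillInput
  fun_prop

lemma fillInput_mem_Icc (hpos : ∀ k, 0 < h k) {A : ℝ} (hA : 0 ≤ A) (u : ℝ) (k : Fin n) :
    fillInput h A u k ∈ Set.Icc 0 A := by
  have hs : sCum h k.val * A ≤ sCum h (k.val + 1) * A :=
    mul_le_mul_of_nonneg_right (sCum_mono hpos (Nat.le_succ _)) hA
  refine ⟨div_nonneg (sub_nonneg.2 (min_le_min_left u hs)) (hpos k).le,
    (div_le_iff₀ (hpos k)).2 ?_⟩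
  rw [sCum_succ, add_mul] at *
  rcases min_choice u (sCum h k.val * A) with hm | hm <;> rw [hm]
  · nlinarith [min_le_left u (sCum h k.val * A + h k * A)]
  · nlinarith [min_le_right u (sCum h k.val * A + h k * A)]

lemma sum_mul_fillInput (hpos : ∀ k, 0 < h k) {A u : ℝ} (hu : u ∈ Set.Icc 0 (sCum h n * A)) :
    ∑ k, h k * fillInput h A u k = u := by
  have hk : ∀ k : Fin n, h k * fillInput h A u k
      = min u (sCum h (k.val + 1) * A) - min u (sCum h k.val * A) := fun k =>
    mul_div_cancel₀ _ (hpos k).ne'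
  simp only [hk]
  rw [sum_fin_telescope n fun k => min u (sCum h k * A), sCum_zero, zero_mul, min_eq_left hu.2,
    min_eq_right hu.1, sub_zero]

/-- The average power of the filling input for a uniform noiseless output. -/
lemma sum_integral_fillInput (hn : 0 < n) (hpos : ∀ k, 0 < h k) {A : ℝ} (hA : 0 < A) :
    ∑ k, ∫ g, fillInput h A (sCum h n * A * cdf (gaussianReal 0 1) g) k ∂gaussianReal 0 1
      = alphaTh h * A := by
  have hS := sCum_pos hn hpos
  have hk : ∀ k : Fin n,
      ∫ g, fillInput h A (sCum h n * A * cdf (gaussianReal 0 1) g) k ∂gaussianReal 0 1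
        = A - A * (sCum h (k.val + 1)
          + sCum h k.val) / (2 * sCum h n) := by
    intro k
    have hmem : ∀ j ≤ n, 0 ≤ sCum h j * A ∧ sCum h j * A ≤ sCum h n * A := fun j hj =>
      ⟨mul_nonneg (sCum_nonneg hpos j) hA.le, mul_le_mul_of_nonneg_right (sCum_mono hpos hj) hA.le⟩
    have h1 := hmem (k.val + 1) k.isLt
    have h2 := hmem k.val k.isLt.le
    simp only [fillInput]
    rw [integral_div, integral_sub (integrable_min_mul_cdf _ _ _) (integrable_min_mul_cdf _ _ _),
      integral_min_mul_cdf (mul_pos hS hA) h1.1 h1.2, integral_min_mul_cdf (mul_pos hS hA) h2.1 h2.2,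
      sCum_succ]
    have := (hpos k).ne'
    field_simp
    ring
  have habel : ∑ k : Fin n, (sCum h (k.val + 1) + sCum h k.val)
      = 2 * n * sCum h n - sCum h n - 2 * ∑ k : Fin n, h k * k.val := by
    have hT := sum_fin_telescope n fun k => 2 * (k : ℝ) * sCum h k - sCum h k
    simp only [sCum_zero, mul_zero, sub_zero] at hT
    rw [Finset.mul_sum, ← hT, ← Finset.sum_sub_distrib]
    refine Finset.sum_congr rfl fun k _ => ?_
    rw [sCum_succ]
    push_cast
    ring
  simp only [hk]
  rw [Finset.sum_sub_distrib, ← Finset.sum_div, ← Finset.mul_sum, habel, alphaTh]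
  simp
  field_simp
  ring

end Input

section Capacity

/-- Information transmitted over the additive Gaussian channel by an input whose noiseless output
is uniform on `[0, L]`. -/
lemma le_mutualInfo_of_uniform_output {E : Type*} [MeasurableSpace E] {m : E → ℝ} {V : ℝ → E}
    (hm : Measurable m) (hV : Measurable V) {L : ℝ} (hL : 0 < L)
    (hmV : ∀ g, m (V g) = L * cdf (gaussianReal 0 1) g) {v : ℝ≥0} (hv : 0 < v) :
    ((1 / 2 * log (1 + L ^ 2 / (2 * π * Real.exp 1 * v)) : ℝ) : EReal)
      ≤ mutualInfo (channelLaw m v ((gaussianReal 0 1).map V)) := by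
  have hv0 : v ≠ 0 := hv.ne'
  have hvpos : (0 : ℝ) < v := hv
  have hμ : IsProbabilityMeasure ((gaussianReal 0 1).map V) :=
    Measure.isProbabilityMeasure_map hV.aemeasurable
  set μ := (gaussianReal 0 1).map V with hμ_def
  set τ : ℝ := √v with hτ_def
  have hτ : 0 < τ := Real.sqrt_pos.2 hvpos
  have hτv : τ ^ 2 = v := Real.sq_sqrt hvpos.le
  set a : ℝ := L ^ 2 / (2 * π * Real.exp 1) with ha_def
  have ha : 0 < a := by positivity
  have hS : 0 < a + v := by positivity
  set c : ℝ := √(a / (a + v)) with hc_def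
  set s : ℝ := √(v / (a + v)) with hs_def
  have hc : 0 < c := Real.sqrt_pos.2 (by positivity)
  have hs : 0 < s := Real.sqrt_pos.2 (by positivity)
  have hc2 : c ^ 2 = a / (a + v) := Real.sq_sqrt (by positivity)
  have hs2 : s ^ 2 = v / (a + v) := Real.sq_sqrt (by positivity)
  have hP : channelLaw m v μ = ((gaussianReal 0 1).prod (gaussianReal 0 1)).map
      (fun z => (V z.1, L * cdf (gaussianReal 0 1) z.1 + τ * z.2)) := by
    have hnoise : gaussianReal 0 v = (gaussianReal 0 1).map (τ * ·) := by
      rw [gaussianReal_map_const_mul]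
      congr 1
      · simp
      · ext
        simp [hτv]
    rw [channelLaw, hnoise, hμ_def, Measure.map_prod_map _ _ hV (by fun_prop),
      Measure.map_map (by fun_prop) (by fun_prop)]
    congr 1
    ext z <;> simp [hmV]
  have hW : Measurable fun z : ℝ × ℝ => (V z.1, L * cdf (gaussianReal 0 1) z.1 + τ * z.2) := by
    have hmeas : Measurable (cdf (gaussianReal 0 1)) := (monotone_cdf _).measurable
    fun_prop
  have hlog : ∀ z : ℝ × ℝ,
      log (gaussianPDFReal (m (V z.1)) v (L * cdf (gaussianReal 0 1) z.1 + τ * z.2)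
          / (outputDensity m v μ (L * cdf (gaussianReal 0 1) z.1 + τ * z.2)).toReal)
        = -(z.2 ^ 2 / 2) - log (2 * π * τ ^ 2) / 2
          - log (outputDensity m v μ (L * cdf (gaussianReal 0 1) z.1 + τ * z.2)).toReal := by
    intro z
    rw [Real.log_div (gaussianPDFReal_pos _ _ _ hv0).ne'
      (ENNReal.toReal_pos (outputDensity_ne_zero hm hv0 _) (outputDensity_ne_top _)).ne',
      gaussianPDFReal, hmV, Real.log_mul (by positivity) (by positivity), Real.log_inv,
      Real.log_exp, Real.log_sqrt (by positivity), hτv, add_sub_cancel_left, mul_pow, hτv]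
    field_simp
    ring
  refine le_mutualInfo_channelLaw hm hv0 fun hg_int => ?_
  have hg_meas : AEStronglyMeasurable (fun p : E × ℝ => log (gaussianPDFReal (m p.1) v p.2
      / (outputDensity m v μ p.2).toReal)) (channelLaw m v μ) := hg_int.aestronglyMeasurable
  rw [hP] at hg_int hg_meas ⊢
  have hg_int' := hg_int.comp_measurable hW
  rw [integral_map hW.aemeasurable hg_meas]
  simp only [Function.comp_def, hlog] at hg_int' ⊢
  have hepi := entropyPower_le_integral (S := a + v) hL hτ hc hs
    (by rw [hc2, hs2]; field_simp) hS
    (by rw [hc2, ha_def]; field_simp) (by rw [hs2, hτv]; field_simp)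
    (measurable_outputDensity hm) (outputDensity_ne_zero hm hv0) outputDensity_ne_top
    (lintegral_outputDensity (μ := μ) hm hv0).le hg_int'
  refine le_trans (le_of_eq ?_) hepi
  have hratio : 1 + L ^ 2 / (2 * π * Real.exp 1 * v) = (a + v) / v := by
    rw [ha_def]
    field_simp
    ring
  rw [hratio, Real.log_div hS.ne' hvpos.ne', hτv]
  ring

end Capacity

theorem miso_capacity_lower_bound_above_threshold (n : ℕ) (hn : 2 ≤ n) (h : Fin n → ℝ)
    (hord : ∀ i j : Fin n, i ≤ j → h j ≤ h i) (hpos : ∀ k, 0 < h k)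
    (v : ℝ≥0) (hv : 0 < v)
    (A α : ℝ) (hA : 0 < A) (hαth : alphaTh h ≤ α) (hαn : α < (n : ℝ) / 2) :
    ((1 / 2 * Real.log (1 + (sCum h n) ^ 2 * A ^ 2 / (2 * π * Real.exp 1 * (v : ℝ))) : ℝ) : EReal)
      ≤ misoCapacity h v A (α * A) := by
  have hn0 : 0 < n := by omega
  set L : ℝ := sCum h n * A with hL_def
  have hL : 0 < L := mul_pos (sCum_pos hn0 hpos) hA
  set V : ℝ → Fin n → ℝ := fun g => fillInput h A (L * cdf (gaussianReal 0 1) g) with hV_def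
  have hV : Measurable V :=
    (measurable_fillInput h A).comp ((monotone_cdf _).measurable.const_mul L)
  have hm : Measurable fun x : Fin n → ℝ => ∑ k, h k * x k := by fun_prop
  have hmV : ∀ g, ∑ k, h k * V g k = L * cdf (gaussianReal 0 1) g := fun g =>
    sum_mul_fillInput hpos ⟨mul_nonneg hL.le (cdf_nonneg _ _),
      mul_le_of_le_one_right hL.le (cdf_le_one _ _)⟩
  have hcap := le_mutualInfo_of_uniform_output hm hV hL hmV hv
  rw [hL_def, mul_pow] at hcap
  refine hcap.trans (le_iSup₂_of_le (f := fun μ _ => mutualInfo (misoJoint h v μ))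
    ((gaussianReal 0 1).map V) ⟨Measure.isProbabilityMeasure_map hV.aemeasurable, fun k => ?_, ?_⟩
    le_rfl)
  · rw [ae_map_iff hV.aemeasurable ((measurable_pi_apply k) measurableSet_Icc)]
    exact ae_of_all _ fun g => fillInput_mem_Icc hpos hA.le _ k
  · have hk : ∀ k, ∫ x, x k ∂(gaussianReal 0 1).map V = ∫ g, V g k ∂gaussianReal 0 1 := fun k =>
      integral_map hV.aemeasurable (measurable_pi_apply k).aestronglyMeasurable
    simp only [hk]
    exact (sum_integral_fillInput hn0 hpos hA).le.trans (mul_le_mul_of_nonneg_right hαth hA.le)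
end
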